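/- arXiv:2110.02758 — 3 statements merged into one kernel-verified Lean document; each statement's English description precedes it below -/
import Mathlib

section
/- Let S and A be finite nonempty sets, p₀ an initial state distribution on S, p the true transition dynamics, π a policy, r : S × A → ℝ a reward function with r(s,a) > 0 for all (s,a), and γ ∈ (0,1) a discount factor. Let q be any learned transition dynamics (q(s'|s,a) ≥ 0, ∑_{s'} q(s'|s,a) = 1) satisfying the support condition: for all s,a,s', if q(s'|s,a) > 0 then p(s'|s,a) > 0. Define the augmented reward r̃(s,a,s') = (1−γ)·log r(s,a) + log(p(s'|s,a)/q(s'|s,a)) − (1−γ)·log(1−γ), and define the objective L = ∑_{t=0}^∞ γ^t ∑_{(τ,s_{t+1})} q^π(τ)·q(s_{t+1}|s_t,a_t)·r̃(s_t,a_t,s_{t+1}), where the inner sum ranges over length-(t+1) trajectory prefixes τ = (s₀,a₀,…,s_t,a_t) extended by one next state s_{t+1} with q(s_{t+1}|s_t,a_t) > 0. Then the logarithm of the expected discounted return under the true dynamics is bounded below by L: log J(π,p) ≥ L. -/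
open scoped BigOperators Classical

noncomputable section

/-- Probability of the length-`(t+1)` trajectory prefix `τ = (s₀,a₀,…,s_t,a_t)` under
initial distribution `p0`, transition dynamics `p`, and policy `pol`:
`p₀(s₀) · (∏_{k=0}^{t-1} π(a_k|s_k)·p(s_{k+1}|s_k,a_k)) · π(a_t|s_t)`. -/
def trajProb {S A : Type*} [Fintype S] [Fintype A]
    (p0 : S → ℝ) (p : S → A → S → ℝ) (pol : S → A → ℝ)
    (t : ℕ) (τ : Fin (t + 1) → S × A) : ℝ :=
  p0 (τ 0).1 *
    (∏ k : Fin t,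
      pol (τ k.castSucc).1 (τ k.castSucc).2 *
        p (τ k.castSucc).1 (τ k.castSucc).2 (τ k.succ).1) *
    pol (τ (Fin.last t)).1 (τ (Fin.last t)).2

lemma aux_sum_traj {S A : Type*} [Fintype S] [Fintype A]
    (p0 : S → ℝ) (p : S → A → S → ℝ) (pol : S → A → ℝ) (d : ℕ → S → ℝ)
    (hd0 : d 0 = p0)
    (hd : ∀ t s', d (t + 1) s' = ∑ s, d t s * ∑ a, pol s a * p s a s') (t : ℕ) :
    ∀ h : S → A → ℝ, ∑ τ : Fin (t + 1) → S × A,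
      trajProb p0 p pol t τ * h (τ (Fin.last t)).1 (τ (Fin.last t)).2
      = ∑ s, d t s * ∑ a, pol s a * h s a := by
  induction t with
  | zero =>
    intro h
    rw [← (Equiv.funUnique (Fin 1) (S × A)).symm.sum_comp, Fintype.sum_prod_type]
    simp [trajProb, hd0, Finset.mul_sum, mul_assoc]
  | succ t ih =>
    intro h
    rw [← (Fin.snocEquiv (fun _ : Fin (t + 2) => S × A)).sum_comp, Fintype.sum_prod_type,
      Finset.sum_comm]
    have key : ∀ (τ : Fin (t + 1) → S × A) (x : S × A),
        trajProb p0 p pol (t + 1) (Fin.snoc (α := fun _ : Fin (t + 2) => S × A) τ x)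
        = trajProb p0 p pol t τ *
          (p (τ (Fin.last t)).1 (τ (Fin.last t)).2 x.1 * pol x.1 x.2) := by
      intro τ x
      have h0 : Fin.snoc (α := fun _ : Fin (t + 2) => S × A) τ x 0 = τ 0 := by
        have := Fin.snoc_castSucc (α := fun _ : Fin (t + 2) => S × A) x τ 0
        simpa using this
      unfold trajProb
      rw [Fin.prod_univ_castSucc]
      simp only [h0, Fin.snoc_castSucc, Fin.snoc_last, Fin.succ_castSucc, Fin.succ_last]
      ring
    have h1 := ih (fun s a => ∑ x : S × A, p s a x.1 * pol x.1 x.2 * h x.1 x.2)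
    calc _ = ∑ τ : Fin (t + 1) → S × A, trajProb p0 p pol t τ *
          ∑ x : S × A, p (τ (Fin.last t)).1 (τ (Fin.last t)).2 x.1 * pol x.1 x.2
            * h x.1 x.2 := by
          refine Finset.sum_congr rfl fun τ _ => ?_
          rw [Finset.mul_sum]
          refine Finset.sum_congr rfl fun x _ => ?_
          simp only [Fin.snocEquiv_apply, Fin.snoc_last]
          refine (congrArg (· * h x.1 x.2) (key τ x)).trans ?_
          ring
      _ = _ := h1
      _ = _ := by
          simp only [hd, Finset.sum_mul, Finset.mul_sum, Fintype.sum_prod_type]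
          rw [Finset.sum_congr rfl (fun s _ => Finset.sum_comm), Finset.sum_comm]
          refine Finset.sum_congr rfl fun s' _ => ?_
          refine (Finset.sum_congr rfl (fun s _ => Finset.sum_comm)).trans ?_
          rw [Finset.sum_comm]
          refine Finset.sum_congr rfl fun a' _ => ?_
          refine Finset.sum_congr rfl fun s _ => ?_
          refine Finset.sum_congr rfl fun a _ => ?_
          ring

lemma aux_bdd {S : Type*} [Fintype S] (d : ℕ → S → ℝ) (hdn : ∀ t s, 0 ≤ d t s)
    (hds : ∀ t, ∑ s, d t s = 1) (f : S → ℝ) :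
    ∀ t, |∑ s, d t s * f s| ≤ ∑ s, |f s| := by
  intro t
  refine (Finset.abs_sum_le_sum_abs _ _).trans (Finset.sum_le_sum fun s _ => ?_)
  rw [abs_mul, abs_of_nonneg (hdn t s)]
  have : d t s ≤ 1 := by
    rw [← hds t]
    exact Finset.single_le_sum (fun i _ => hdn t i) (Finset.mem_univ s)
  exact mul_le_of_le_one_left (abs_nonneg _) this

lemma aux_tele {S : Type*} [Fintype S] (γ : ℝ) (hγ0 : 0 < γ) (hγ1 : γ < 1)
    (d : ℕ → S → ℝ) (hdn : ∀ t s, 0 ≤ d t s) (hds : ∀ t, ∑ s, d t s = 1)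
    (K : S → S → ℝ) (hd : ∀ t s', d (t + 1) s' = ∑ s, d t s * K s s')
    (f c : S → ℝ) (hf : ∀ s, c s + γ * ∑ s', K s s' * f s' ≤ f s) :
    ∑' t : ℕ, γ ^ t * ∑ s, d t s * c s ≤ ∑ s, d 0 s * f s := by
  have hsum : Summable fun t : ℕ => γ ^ t * ∑ s, d t s * c s := by
    refine Summable.of_norm_bounded (g := fun t : ℕ => γ ^ t * ∑ s, |c s|)
      ((summable_geometric_of_lt_one hγ0.le hγ1).mul_right _) fun t => ?_
    rw [Real.norm_eq_abs, abs_mul, abs_of_nonneg (pow_nonneg hγ0.le t)]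
    exact mul_le_mul_of_nonneg_left (aux_bdd d hdn hds c t) (pow_nonneg hγ0.le t)
  have step : ∀ t, ∑ s, d t s * c s + γ * ∑ s, d (t + 1) s * f s ≤ ∑ s, d t s * f s := by
    intro t
    have : ∑ s, d (t + 1) s * f s = ∑ s, d t s * ∑ s', K s s' * f s' := by
      simp only [hd, Finset.sum_mul, Finset.mul_sum]
      rw [Finset.sum_comm]
      simp only [mul_assoc]
    rw [this, Finset.mul_sum, ← Finset.sum_add_distrib]
    refine Finset.sum_le_sum fun s _ => ?_
    nlinarith [mul_le_mul_of_nonneg_left (hf s) (hdn t s)]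
  have part : ∀ n : ℕ, ∑ t ∈ Finset.range n, γ ^ t * ∑ s, d t s * c s
      ≤ ∑ s, d 0 s * f s - γ ^ n * ∑ s, d n s * f s := by
    intro n
    induction n with
    | zero => simp
    | succ n ih =>
      rw [Finset.sum_range_succ, pow_succ]
      nlinarith [mul_le_mul_of_nonneg_left (step n) (pow_nonneg hγ0.le n)]
  have lim : Filter.Tendsto (fun n : ℕ => ∑ s, d 0 s * f s + γ ^ n * ∑ s, |f s|)
      Filter.atTop (nhds (∑ s, d 0 s * f s)) := by
    have := ((tendsto_pow_atTop_nhds_zero_of_lt_one hγ0.le hγ1).mul_const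
      (∑ s, |f s|)).const_add (∑ s, d 0 s * f s)
    simpa using this
  refine le_of_tendsto_of_tendsto' hsum.hasSum.tendsto_sum_nat lim fun n => (part n).trans ?_
  have h1 := neg_le_of_abs_le (aux_bdd d hdn hds f n)
  nlinarith [mul_le_mul_of_nonneg_left h1 (pow_nonneg hγ0.le n)]

lemma aux_min {S : Type*} [Fintype S] [Nonempty S] (γ : ℝ) (hγ0 : 0 < γ) (hγ1 : γ < 1)
    (K : S → S → ℝ) (hK0 : ∀ s s', 0 ≤ K s s') (hK1 : ∀ s, ∑ s', K s s' = 1)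
    (f : S → ℝ) (hf : ∀ s, γ * ∑ s', K s s' * f s' ≤ f s) : ∀ s, 0 ≤ f s := by
  obtain ⟨m, hm⟩ := Finite.exists_min f
  have h1 : f m ≤ ∑ s', K m s' * f s' := by
    calc f m = ∑ s', K m s' * f m := by rw [← Finset.sum_mul, hK1, one_mul]
      _ ≤ _ := Finset.sum_le_sum fun s' _ => mul_le_mul_of_nonneg_left (hm s') (hK0 m s')
  have h2 := hf m
  have h3 : 0 ≤ f m := by nlinarith [mul_le_mul_of_nonneg_left h1 hγ0.le]
  exact fun s => h3.trans (hm s)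

lemma aux_value {S : Type*} [Fintype S] [Nonempty S] (γ : ℝ) (hγ0 : 0 < γ) (hγ1 : γ < 1)
    (K : S → S → ℝ) (hK0 : ∀ s s', 0 ≤ K s s') (hK1 : ∀ s, ∑ s', K s s' = 1)
    (R : S → ℝ) (hR : ∀ s, 0 < R s) :
    ∃ V : S → ℝ, (∀ s, 0 < V s) ∧ ∀ s, V s = R s + γ * ∑ s', K s s' * V s' := by
  let T : (S → ℝ) →ₗ[ℝ] (S → ℝ) :=
    { toFun := fun f s => f s - γ * ∑ s', K s s' * f s'
      map_add' := by
        intro f g; ext s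
        simp only [Pi.add_apply, mul_add, Finset.sum_add_distrib]; ring
      map_smul' := by
        intro c f; ext s
        have : ∑ s', K s s' * (c * f s') = c * ∑ s', K s s' * f s' := by
          rw [Finset.mul_sum]; exact Finset.sum_congr rfl fun _ _ => by ring
        simp only [Pi.smul_apply, smul_eq_mul, RingHom.id_apply, this]; ring }
  have hT : ∀ f s, T f s = f s - γ * ∑ s', K s s' * f s' := fun _ _ => rfl
  have hpos : ∀ f, (∀ s, 0 ≤ T f s) → ∀ s, 0 ≤ f s := fun f hf =>
    aux_min γ hγ0 hγ1 K hK0 hK1 f fun s => by have := hf s; rw [hT] at this; linarith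
  have hinj : Function.Injective T := by
    rw [injective_iff_map_eq_zero]
    intro f hf
    ext s
    have h1 := hpos f (fun s => by simp [hf]) s
    have h2 := hpos (-f) (fun s => by rw [map_neg, hf]; simp) s
    simp only [Pi.neg_apply] at h2
    simp only [Pi.zero_apply]
    linarith
  obtain ⟨V, hV⟩ := LinearMap.surjective_of_injective hinj R
  have hV' : ∀ s, V s = R s + γ * ∑ s', K s s' * V s' := fun s => by
    rw [← hV, hT]; ring
  have hn : ∀ s, 0 ≤ V s := hpos V fun s => by rw [hV]; exact (hR s).le
  refine ⟨V, fun s => ?_, hV'⟩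
  rw [hV']
  have : 0 ≤ ∑ s', K s s' * V s' := Finset.sum_nonneg fun s' _ => mul_nonneg (hK0 s s') (hn s')
  have := hR s
  positivity

lemma aux_jensen {ι : Type*} [Fintype ι] (w x : ι → ℝ) (hw : ∀ i, 0 ≤ w i)
    (hw1 : ∑ i, w i = 1) (hx : ∀ i, 0 < x i) :
    ∑ i, w i * Real.log (x i) ≤ Real.log (∑ i, w i * x i) := by
  have := strictConcaveOn_log_Ioi.concaveOn.le_map_sum (t := Finset.univ) (w := w) (p := x)
    (fun i _ => hw i) hw1 (fun i _ => hx i)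
  simpa using this

/-- Change of measure plus Jensen. -/
lemma aux_gibbs {S : Type*} [Fintype S] (p q V : S → ℝ) (hp : ∀ s, 0 ≤ p s)
    (hq : ∀ s, 0 ≤ q s) (hq1 : ∑ s, q s = 1) (hs : ∀ s, 0 < q s → 0 < p s)
    (hV : ∀ s, 0 < V s) :
    0 < ∑ s, p s * V s ∧
    ∑ s, q s * (Real.log (p s / q s) + Real.log (V s)) ≤ Real.log (∑ s, p s * V s) := by
  let x : S → ℝ := fun s => if 0 < q s then p s / q s * V s else 1
  have hx : ∀ s, 0 < x s := by
    intro s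
    by_cases h : 0 < q s
    · have := hs s h
      have := hV s
      simp only [x, h, if_true]; positivity
    · simp [x, h]
  have hle : ∀ s, q s * x s ≤ p s * V s := by
    intro s
    by_cases h : 0 < q s
    · simp only [x, h, if_true]
      apply le_of_eq
      field_simp
    · have : q s = 0 := le_antisymm (not_lt.mp h) (hq s)
      rw [this, zero_mul]
      exact mul_nonneg (hp s) (hV s).le
  have hpos : 0 < ∑ s, q s * x s := by
    refine Finset.sum_pos' (fun s _ => mul_nonneg (hq s) (hx s).le) ?_
    by_contra hcon
    push Not at hcon
    have : ∑ s, q s = 0 := Finset.sum_eq_zero fun s _ => by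
      have h1 := hcon s (Finset.mem_univ s)
      by_contra hne
      exact absurd (mul_pos (lt_of_le_of_ne (hq s) (Ne.symm hne)) (hx s)) (not_lt.mpr h1)
    linarith
  have hsum := Finset.sum_le_sum (s := Finset.univ) (fun s _ => hle s)
  refine ⟨hpos.trans_le hsum, ?_⟩
  calc _ = ∑ s, q s * Real.log (x s) := by
        refine Finset.sum_congr rfl fun s _ => ?_
        by_cases h : 0 < q s
        · have h1 : p s / q s ≠ 0 := (div_pos (hs s h) h).ne'
          simp only [x, h, if_true]
          rw [Real.log_mul h1 (hV s).ne']
        · have : q s = 0 := le_antisymm (not_lt.mp h) (hq s)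
          simp [this]
    _ ≤ _ := aux_jensen q x hq hq1 hx
    _ ≤ _ := Real.log_le_log hpos hsum

lemma aux_step (γ : ℝ) (hγ0 : 0 < γ) (hγ1 : γ < 1)
    {S : Type*} [Fintype S] (p q V : S → ℝ) (hp : ∀ s, 0 ≤ p s) (hp1 : ∑ s, p s = 1)
    (hq : ∀ s, 0 ≤ q s) (hq1 : ∑ s, q s = 1) (hs : ∀ s, 0 < q s → 0 < p s)
    (hV : ∀ s, 0 < V s) (r : ℝ) (hr : 0 < r) :
    ∑ s, q s * ((1 - γ) * Real.log r + Real.log (p s / q s) - (1 - γ) * Real.log (1 - γ))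
      + γ * ∑ s, q s * Real.log (V s) ≤ Real.log (r + γ * ∑ s, p s * V s) := by
  obtain ⟨hM, h1⟩ := aux_gibbs p q V hp hq hq1 hs hV
  have h2 := (aux_gibbs p q (fun _ => 1) hp hq hq1 hs (fun _ => one_pos)).2
  simp only [Real.log_one, add_zero, mul_one, hp1] at h2
  simp only [mul_add, Finset.sum_add_distrib] at h1
  have h1g : 0 < 1 - γ := by linarith
  have h3 := strictConcaveOn_log_Ioi.concaveOn.2 (x := r / (1 - γ)) (y := ∑ s, p s * V s)
    (Set.mem_Ioi.mpr (div_pos hr h1g)) (Set.mem_Ioi.mpr hM) h1g.le hγ0.le (by ring)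
  simp only [smul_eq_mul] at h3
  rw [mul_div_cancel₀ _ h1g.ne', Real.log_div hr.ne' h1g.ne'] at h3
  have h4 : ∑ s, q s * ((1 - γ) * Real.log r + Real.log (p s / q s)
      - (1 - γ) * Real.log (1 - γ)) = (1 - γ) * Real.log r + ∑ s, q s * Real.log (p s / q s)
      - (1 - γ) * Real.log (1 - γ) := by
    simp only [mul_add, mul_sub, Finset.sum_add_distrib, Finset.sum_sub_distrib,
      ← Finset.sum_mul, hq1, one_mul]
  rw [h4]
  nlinarith [mul_le_mul_of_nonneg_left h1 hγ0.le, mul_nonneg h1g.le (neg_nonneg.mpr h2)]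

/-- State marginals. -/
def auxDist {S : Type*} [Fintype S] (p0 : S → ℝ) (K : S → S → ℝ) : ℕ → S → ℝ
  | 0 => p0
  | t + 1 => fun s' => ∑ s, auxDist p0 K t s * K s s'

lemma auxDist_prob {S : Type*} [Fintype S] (p0 : S → ℝ) (K : S → S → ℝ)
    (h0 : ∀ s, 0 ≤ p0 s) (h1 : ∑ s, p0 s = 1)
    (hK0 : ∀ s s', 0 ≤ K s s') (hK1 : ∀ s, ∑ s', K s s' = 1) (t : ℕ) :
    (∀ s, 0 ≤ auxDist p0 K t s) ∧ ∑ s, auxDist p0 K t s = 1 := by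
  induction t with
  | zero => exact ⟨h0, h1⟩
  | succ t ih =>
    refine ⟨fun s' => Finset.sum_nonneg fun s _ => mul_nonneg (ih.1 s) (hK0 s s'), ?_⟩
    simp only [auxDist]
    rw [Finset.sum_comm]
    simp only [← Finset.mul_sum, hK1, mul_one, ih.2]

lemma aux_kernel {S A : Type*} [Fintype S] [Fintype A]
    (p : S → A → S → ℝ) (hp1 : ∀ s a, ∑ s', p s a s' = 1)
    (pol : S → A → ℝ) (hpol1 : ∀ s, ∑ a, pol s a = 1) (s : S) :
    ∑ s', ∑ a, pol s a * p s a s' = 1 := by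
  rw [Finset.sum_comm]
  simp only [← Finset.mul_sum, hp1, mul_one, hpol1]

lemma aux_swap {S A : Type*} [Fintype S] [Fintype A]
    (p : S → A → S → ℝ) (pol : S → A → ℝ) (f : S → ℝ) (s : S) :
    ∑ s', (∑ a, pol s a * p s a s') * f s' = ∑ a, pol s a * ∑ s', p s a s' * f s' := by
  simp only [Finset.sum_mul, Finset.mul_sum]
  rw [Finset.sum_comm]
  simp only [mul_assoc]

/-- **Theorem 1 (MnM lower bound).** For any learned dynamics `q` whose support is contained
in the support of the true dynamics `p`, the objective
`L = ∑_t γ^t ∑_{(τ,s')} q^π(τ) q(s'|s_t,a_t) r̃(s_t,a_t,s')`, with augmented reward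
`r̃(s,a,s') = (1−γ) log r(s,a) + log (p(s'|s,a)/q(s'|s,a)) − (1−γ) log (1−γ)`,
is a lower bound on the log of the expected discounted return under the true dynamics. -/
theorem mnm_lower_bound
    {S A : Type*} [Fintype S] [Fintype A] [Nonempty S] [Nonempty A]
    (p0 : S → ℝ) (hp00 : ∀ s, 0 ≤ p0 s) (hp01 : ∑ s, p0 s = 1)
    (p : S → A → S → ℝ) (hp0 : ∀ s a s', 0 ≤ p s a s') (hp1 : ∀ s a, ∑ s', p s a s' = 1)
    (pol : S → A → ℝ) (hpol0 : ∀ s a, 0 ≤ pol s a) (hpol1 : ∀ s, ∑ a, pol s a = 1)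
    (r : S → A → ℝ) (hr : ∀ s a, 0 < r s a)
    (γ : ℝ) (hγ0 : 0 < γ) (hγ1 : γ < 1)
    (q : S → A → S → ℝ) (hq0 : ∀ s a s', 0 ≤ q s a s') (hq1 : ∀ s a, ∑ s', q s a s' = 1)
    (hsupp : ∀ s a s', 0 < q s a s' → 0 < p s a s') :
    (∑' t : ℕ, γ ^ t *
        ∑ τ : Fin (t + 1) → S × A, ∑ s' : S,
          (if 0 < q (τ (Fin.last t)).1 (τ (Fin.last t)).2 s' then
            trajProb p0 q pol t τ * q (τ (Fin.last t)).1 (τ (Fin.last t)).2 s' *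
              ((1 - γ) * Real.log (r (τ (Fin.last t)).1 (τ (Fin.last t)).2) +
                Real.log (p (τ (Fin.last t)).1 (τ (Fin.last t)).2 s' /
                  q (τ (Fin.last t)).1 (τ (Fin.last t)).2 s') -
                (1 - γ) * Real.log (1 - γ))
          else 0))
      ≤ Real.log (∑' t : ℕ, γ ^ t *
          ∑ τ : Fin (t + 1) → S × A,
            trajProb p0 p pol t τ * r (τ (Fin.last t)).1 (τ (Fin.last t)).2) := by
  let Kp : S → S → ℝ := fun s s' => ∑ a, pol s a * p s a s'
  let Kq : S → S → ℝ := fun s s' => ∑ a, pol s a * q s a s'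
  have hKp0 : ∀ s s', 0 ≤ Kp s s' := fun s s' =>
    Finset.sum_nonneg fun a _ => mul_nonneg (hpol0 s a) (hp0 s a s')
  have hKq0 : ∀ s s', 0 ≤ Kq s s' := fun s s' =>
    Finset.sum_nonneg fun a _ => mul_nonneg (hpol0 s a) (hq0 s a s')
  have hKp1 : ∀ s, ∑ s', Kp s s' = 1 := aux_kernel p hp1 pol hpol1
  have hKq1 : ∀ s, ∑ s', Kq s s' = 1 := aux_kernel q hq1 pol hpol1
  have hdp := auxDist_prob p0 Kp hp00 hp01 hKp0 hKp1
  have hdq := auxDist_prob p0 Kq hp00 hp01 hKq0 hKq1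
  let R : S → ℝ := fun s => ∑ a, pol s a * r s a
  have hR : ∀ s, 0 < R s := by
    intro s
    refine Finset.sum_pos' (fun a _ => mul_nonneg (hpol0 s a) (hr s a).le) ?_
    by_contra hcon
    push Not at hcon
    have : ∑ a, pol s a = 0 := Finset.sum_eq_zero fun a _ => by
      have h1 := hcon a (Finset.mem_univ a)
      by_contra hne
      exact absurd (mul_pos (lt_of_le_of_ne (hpol0 s a) (Ne.symm hne)) (hr s a))
        (not_lt.mpr h1)
    linarith [hpol1 s]
  obtain ⟨V, hVpos, hV⟩ := aux_value γ hγ0 hγ1 Kp hKp0 hKp1 R hR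
  -- the return equals the initial expectation of the value function
  have hJ : (∑' t : ℕ, γ ^ t * ∑ τ : Fin (t + 1) → S × A,
      trajProb p0 p pol t τ * r (τ (Fin.last t)).1 (τ (Fin.last t)).2)
      = ∑ s, p0 s * V s := by
    have e : ∀ t : ℕ, ∑ τ : Fin (t + 1) → S × A,
        trajProb p0 p pol t τ * r (τ (Fin.last t)).1 (τ (Fin.last t)).2
        = ∑ s, auxDist p0 Kp t s * R s := fun t =>
      aux_sum_traj p0 p pol (auxDist p0 Kp) rfl (fun _ _ => rfl) t r
    simp only [e]
    apply le_antisymm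
    · exact aux_tele γ hγ0 hγ1 (auxDist p0 Kp) (fun t => (hdp t).1) (fun t => (hdp t).2) Kp
        (fun _ _ => rfl) V R (fun s => (hV s).ge)
    · have := aux_tele γ hγ0 hγ1 (auxDist p0 Kp) (fun t => (hdp t).1) (fun t => (hdp t).2) Kp
        (fun _ _ => rfl) (fun s => - V s) (fun s => - R s) (fun s => by
          simp only [mul_neg, Finset.sum_neg_distrib]
          linarith [hV s])
      simp only [mul_neg, Finset.sum_neg_distrib, tsum_neg] at this
      exact neg_le_neg_iff.mp this
  rw [hJ]
  let c : S → A → ℝ := fun s a => ∑ s', q s a s' * ((1 - γ) * Real.log (r s a) +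
    Real.log (p s a s' / q s a s') - (1 - γ) * Real.log (1 - γ))
  have hL : ∀ t : ℕ, (∑ τ : Fin (t + 1) → S × A, ∑ s' : S,
          (if 0 < q (τ (Fin.last t)).1 (τ (Fin.last t)).2 s' then
            trajProb p0 q pol t τ * q (τ (Fin.last t)).1 (τ (Fin.last t)).2 s' *
              ((1 - γ) * Real.log (r (τ (Fin.last t)).1 (τ (Fin.last t)).2) +
                Real.log (p (τ (Fin.last t)).1 (τ (Fin.last t)).2 s' /
                  q (τ (Fin.last t)).1 (τ (Fin.last t)).2 s') -
                (1 - γ) * Real.log (1 - γ))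
          else 0)) = ∑ s, auxDist p0 Kq t s * ∑ a, pol s a * c s a := by
    intro t
    rw [← aux_sum_traj p0 q pol (auxDist p0 Kq) rfl (fun _ _ => rfl) t c]
    refine Finset.sum_congr rfl fun τ _ => ?_
    simp only [c]
    rw [Finset.mul_sum]
    refine Finset.sum_congr rfl fun s' _ => ?_
    split_ifs with h
    · ring
    · have : q (τ (Fin.last t)).1 (τ (Fin.last t)).2 s' = 0 :=
        le_antisymm (not_lt.mp h) (hq0 _ _ _)
      rw [this]; ring
  simp only [hL]
  refine (aux_tele γ hγ0 hγ1 (auxDist p0 Kq) (fun t => (hdq t).1) (fun t => (hdq t).2) Kq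
    (fun _ _ => rfl) (fun s => Real.log (V s)) (fun s => ∑ a, pol s a * c s a) ?_).trans
    (aux_jensen p0 V hp00 hp01 hVpos)
  intro s
  have hstep : ∀ a, c s a + γ * ∑ s', q s a s' * Real.log (V s')
      ≤ Real.log (r s a + γ * ∑ s', p s a s' * V s') := fun a =>
    aux_step γ hγ0 hγ1 (p s a) (q s a) V (hp0 s a) (hp1 s a) (hq0 s a) (hq1 s a)
      (hsupp s a) hVpos (r s a) (hr s a)
  have hVs : V s = ∑ a, pol s a * (r s a + γ * ∑ s', p s a s' * V s') := by
    rw [hV s]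
    simp only [Kp, R]
    rw [aux_swap p pol V s, Finset.mul_sum, ← Finset.sum_add_distrib]
    exact Finset.sum_congr rfl fun a _ => by ring
  have hj := aux_jensen (pol s) (fun a => r s a + γ * ∑ s', p s a s' * V s') (hpol0 s)
    (hpol1 s) (fun a => by
      have h1 : 0 ≤ ∑ s', p s a s' * V s' :=
        Finset.sum_nonneg fun s' _ => mul_nonneg (hp0 s a s') (hVpos s').le
      have := hr s a
      positivity)
  rw [← hVs] at hj
  refine le_trans ?_ hj
  simp only [Kq]
  rw [aux_swap q pol (fun s' => Real.log (V s')) s, Finset.mul_sum, ← Finset.sum_add_distrib]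
  refine Finset.sum_le_sum fun a _ => ?_
  nlinarith [mul_le_mul_of_nonneg_left (hstep a) (hpol0 s a)]
end
end

section
/- Let S and A be finite nonempty sets, p₀ an initial state distribution on S, p the true transition dynamics, π a policy, r : S × A → ℝ with r(s,a) > 0 for all (s,a), and γ ∈ (0,1). Let X denote the countable set of pairs (H, τ) where H ∈ ℕ and τ = (s₀,a₀,…,s_H,a_H) ∈ (S×A)^{H+1} is a length-(H+1) trajectory prefix, and define the joint distribution p̄(H,τ) = (1−γ)·γ^H·p^π(τ), which is a probability mass function on X. Then: (i) ∑_{(H,τ)∈X} p̄(H,τ)·r(s_H,a_H) = (1−γ)·J(π,p); and (ii) for every probability mass function q̄ on X whose support is contained in the support of p̄ and with ∑ q̄·|log(p̄·r/q̄)| < ∞, one has ∑_{(H,τ): q̄(H,τ)>0} q̄(H,τ)·(log p̄(H,τ) + log r(s_H,a_H) − log q̄(H,τ)) − log(1−γ) ≤ log J(π,p), with equality if and only if q̄(H,τ) = p̄(H,τ)·r(s_H,a_H)/((1−γ)·J(π,p)) for all (H,τ). In particular the supremum of the left-hand side over all such q̄ equals log J(π,p). -/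
open scoped BigOperators Classical

noncomputable section

/-- The joint distribution `p̄(H,τ) = (1−γ)·γ^H·p^π(τ)` on horizon–trajectory pairs. -/
def jointProb {S A : Type*} [Fintype S] [Fintype A]
    (p0 : S → ℝ) (p : S → A → S → ℝ) (pol : S → A → ℝ) (γ : ℝ)
    (x : Σ H : ℕ, Fin (H + 1) → S × A) : ℝ :=
  (1 - γ) * γ ^ x.1 * trajProb p0 p pol x.1 x.2

/-- The reward at the final step of a horizon–trajectory pair: `r(s_H, a_H)`. -/
def lastReward {S A : Type*} (r : S → A → ℝ)
    (x : Σ H : ℕ, Fin (H + 1) → S × A) : ℝ :=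
  r (x.2 (Fin.last x.1)).1 (x.2 (Fin.last x.1)).2

theorem trajProb_nonneg_aux {S A : Type*} [Fintype S] [Fintype A]
    (p0 : S → ℝ) (hp00 : ∀ s, 0 ≤ p0 s)
    (p : S → A → S → ℝ) (hp0 : ∀ s a s', 0 ≤ p s a s')
    (pol : S → A → ℝ) (hpol0 : ∀ s a, 0 ≤ pol s a)
    (t : ℕ) (τ : Fin (t + 1) → S × A) : 0 ≤ trajProb p0 p pol t τ := by
  unfold trajProb
  exact mul_nonneg (mul_nonneg (hp00 _)
    (Finset.prod_nonneg fun k _ => mul_nonneg (hpol0 _ _) (hp0 _ _ _))) (hpol0 _ _)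

theorem trajProb_cons_aux {S A : Type*} [Fintype S] [Fintype A]
    (p0 : S → ℝ) (p : S → A → S → ℝ) (pol : S → A → ℝ)
    (t : ℕ) (x : S × A) (τ : Fin (t + 1) → S × A) :
    trajProb p0 p pol (t + 1) (Fin.cons x τ : Fin (t + 2) → S × A)
      = p0 x.1 * pol x.1 x.2 * trajProb (p x.1 x.2) p pol t τ := by
  unfold trajProb
  rw [Fin.prod_univ_succ]
  have h : ∀ k : Fin t, (Fin.cons x τ : Fin (t + 2) → S × A) (k.succ.castSucc)
      = τ k.castSucc := by
    intro k
    rw [← Fin.succ_castSucc, Fin.cons_succ]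
  have h2 : (Fin.cons x τ : Fin (t + 2) → S × A) (Fin.last (t + 1)) = τ (Fin.last t) := by
    rw [← Fin.succ_last, Fin.cons_succ]
  simp only [h, h2, Fin.cons_succ, Fin.castSucc_zero, Fin.cons_zero]
  ring

theorem trajProb_sum_aux {S A : Type*} [Fintype S] [Fintype A]
    (p : S → A → S → ℝ) (hp1 : ∀ s a, ∑ s', p s a s' = 1)
    (pol : S → A → ℝ) (hpol1 : ∀ s, ∑ a, pol s a = 1) (t : ℕ) :
    ∀ (p0 : S → ℝ), ∑ s, p0 s = 1 →
      ∑ τ : Fin (t + 1) → S × A, trajProb p0 p pol t τ = 1 := by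
  induction t with
  | zero =>
    intro p0 hp01
    rw [← (Equiv.funUnique (Fin 1) (S × A)).symm.sum_comp]
    simp [trajProb, Fintype.sum_prod_type, ← Finset.mul_sum, hpol1, hp01]
  | succ t ih =>
    intro p0 hp01
    rw [← (Fin.consEquiv fun _ : Fin (t + 2) => S × A).sum_comp, Fintype.sum_prod_type]
    have e : ∀ (x : S × A) (τ : Fin (t + 1) → S × A), trajProb p0 p pol (t + 1)
        ((Fin.consEquiv fun _ : Fin (t + 2) => S × A) (x, τ))
        = p0 x.1 * pol x.1 x.2 * trajProb (p x.1 x.2) p pol t τ :=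
      fun x τ => trajProb_cons_aux p0 p pol t x τ
    have e2 : ∀ x : S × A, ∑ τ : Fin (t + 1) → S × A, trajProb p0 p pol (t + 1)
        ((Fin.consEquiv fun _ : Fin (t + 2) => S × A) (x, τ)) = p0 x.1 * pol x.1 x.2 := by
      intro x
      rw [Finset.sum_congr rfl fun τ _ => e x τ, ← Finset.mul_sum, ih _ (hp1 _ _), mul_one]
    refine (Finset.sum_congr rfl fun x _ => e2 x).trans ?_
    simp [Fintype.sum_prod_type, ← Finset.mul_sum, hpol1, hp01]

/-- pointwise Gibbs inequality -/
theorem gibbs_point_aux {f q Z : ℝ} (hf : 0 ≤ f) (hZ : 0 < Z) (hq : 0 ≤ q)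
    (hqf : 0 < q → 0 < f) :
    0 ≤ f / Z - q + q * Real.log Z - (if 0 < q then q * Real.log (f / q) else 0) ∧
    (f / Z - q + q * Real.log Z - (if 0 < q then q * Real.log (f / q) else 0) = 0
      ↔ q = f / Z) := by
  rcases hq.eq_or_lt with h | h
  · subst h
    simp only [lt_irrefl, if_false]
    have : 0 ≤ f / Z := by positivity
    constructor
    · linarith
    · constructor <;> intro h <;> linarith
  · have hf' := hqf h
    simp only [h, if_true]
    have hy : 0 < f / Z / q := by positivity
    have e : f / Z - q + q * Real.log Z - q * Real.log (f / q)
        = q * (f / Z / q - 1 - Real.log (f / Z / q)) := by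
      rw [Real.log_div (div_pos hf' hZ).ne' h.ne', Real.log_div hf'.ne' h.ne',
        Real.log_div hf'.ne' hZ.ne']
      field_simp
      ring
    rw [e]
    have h1 := Real.log_le_sub_one_of_pos hy
    refine ⟨mul_nonneg hq (by linarith), ?_, ?_⟩
    · intro h0
      by_contra hne
      have hy1 : f / Z / q ≠ 1 := by
        intro h2
        rw [div_eq_one_iff_eq h.ne'] at h2
        exact hne h2.symm
      have := Real.log_lt_sub_one_of_pos hy hy1
      have := mul_pos h (show 0 < f / Z / q - 1 - Real.log (f / Z / q) by linarith)
      linarith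
    · intro h0
      rw [← h0, div_self h.ne']
      simp

theorem gibbs_aux {X : Type*} (f q : X → ℝ) (Z : ℝ) (hf : ∀ x, 0 ≤ f x) (hZ : 0 < Z)
    (hfs : HasSum f Z) (hq : ∀ x, 0 ≤ q x) (hqs : HasSum q 1) (hqf : ∀ x, 0 < q x → 0 < f x)
    (hs : Summable fun x => if 0 < q x then q x * |Real.log (f x / q x)| else 0) :
    (∑' x, if 0 < q x then q x * Real.log (f x / q x) else 0) ≤ Real.log Z ∧
    ((∑' x, if 0 < q x then q x * Real.log (f x / q x) else 0) = Real.log Z ↔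
      ∀ x, q x = f x / Z) := by
  have hg : Summable fun x => if 0 < q x then q x * Real.log (f x / q x) else 0 := by
    refine Summable.of_norm_bounded hs fun x => ?_
    split_ifs with h
    · rw [Real.norm_eq_abs, abs_mul, abs_of_pos h]
    · simp
  have hh := (((hfs.div_const Z).sub hqs).add (hqs.mul_right (Real.log Z))).sub hg.hasSum
  rw [div_self hZ.ne'] at hh
  set G := ∑' x, if 0 < q x then q x * Real.log (f x / q x) else 0
  have hp := fun x => gibbs_point_aux (hf x) hZ (hq x) (hqf x)
  have hnn := hh.nonneg fun x => (hp x).1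
  refine ⟨by linarith, ?_⟩
  have h0 := hasSum_zero_iff_of_nonneg (L := SummationFilter.unconditional X)
    (fun x => (hp x).1)
  constructor
  · intro hG x
    have e : (1 - 1 + 1 * Real.log Z - G) = 0 := by rw [hG]; ring
    rw [e] at hh
    exact (hp x).2.1 (congrFun (h0.1 hh) x)
  · intro hx
    have h1 := h0.2 (funext fun x => (hp x).2.2 (hx x))
    have := hh.unique h1
    linarith

/-- **Lemma 2 (tightened lower bound).** With `p̄(H,τ) = (1−γ)γ^H p^π(τ)`:
(i) `∑ p̄·r = (1−γ)·J(π,p)`; (ii) for every pmf `q̄` supported inside the support of `p̄`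
with `∑ q̄·|log(p̄·r/q̄)| < ∞`, the objective
`∑_{q̄>0} q̄·(log p̄ + log r − log q̄) − log(1−γ)` is at most `log J(π,p)`, with equality iff
`q̄ = p̄·r/((1−γ)·J(π,p))`; hence the supremum of the objective over such `q̄` is `log J(π,p)`. -/
theorem tight_lower_bound
    {S A : Type*} [Fintype S] [Fintype A] [Nonempty S] [Nonempty A]
    (p0 : S → ℝ) (hp00 : ∀ s, 0 ≤ p0 s) (hp01 : ∑ s, p0 s = 1)
    (p : S → A → S → ℝ) (hp0 : ∀ s a s', 0 ≤ p s a s') (hp1 : ∀ s a, ∑ s', p s a s' = 1)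
    (pol : S → A → ℝ) (hpol0 : ∀ s a, 0 ≤ pol s a) (hpol1 : ∀ s, ∑ a, pol s a = 1)
    (r : S → A → ℝ) (hr : ∀ s a, 0 < r s a)
    (γ : ℝ) (hγ0 : 0 < γ) (hγ1 : γ < 1) :
    -- the expected discounted return
    (∑' x : Σ H : ℕ, Fin (H + 1) → S × A,
        jointProb p0 p pol γ x * lastReward r x)
      = (1 - γ) * (∑' t : ℕ, γ ^ t *
          ∑ τ : Fin (t + 1) → S × A,
            trajProb p0 p pol t τ * r (τ (Fin.last t)).1 (τ (Fin.last t)).2) ∧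
    (∀ qb : (Σ H : ℕ, Fin (H + 1) → S × A) → ℝ,
      (∀ x, 0 ≤ qb x) → (∑' x, qb x) = 1 →
      (∀ x, 0 < qb x → 0 < jointProb p0 p pol γ x) →
      (Summable fun x =>
        if 0 < qb x then
          qb x * |Real.log (jointProb p0 p pol γ x * lastReward r x / qb x)| else 0) →
      ((∑' x, if 0 < qb x then
            qb x * (Real.log (jointProb p0 p pol γ x) + Real.log (lastReward r x)
              - Real.log (qb x)) else 0) - Real.log (1 - γ)
          ≤ Real.log (∑' t : ℕ, γ ^ t *
              ∑ τ : Fin (t + 1) → S × A,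
                trajProb p0 p pol t τ * r (τ (Fin.last t)).1 (τ (Fin.last t)).2) ∧
        ((∑' x, if 0 < qb x then
              qb x * (Real.log (jointProb p0 p pol γ x) + Real.log (lastReward r x)
                - Real.log (qb x)) else 0) - Real.log (1 - γ)
            = Real.log (∑' t : ℕ, γ ^ t *
                ∑ τ : Fin (t + 1) → S × A,
                  trajProb p0 p pol t τ * r (τ (Fin.last t)).1 (τ (Fin.last t)).2) ↔
          ∀ x, qb x = jointProb p0 p pol γ x * lastReward r x /
              ((1 - γ) * (∑' t : ℕ, γ ^ t *
                ∑ τ : Fin (t + 1) → S × A,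
                  trajProb p0 p pol t τ *
                    r (τ (Fin.last t)).1 (τ (Fin.last t)).2))))) ∧
    sSup {L : ℝ | ∃ qb : (Σ H : ℕ, Fin (H + 1) → S × A) → ℝ,
        (∀ x, 0 ≤ qb x) ∧ (∑' x, qb x) = 1 ∧
        (∀ x, 0 < qb x → 0 < jointProb p0 p pol γ x) ∧
        (Summable fun x =>
          if 0 < qb x then
            qb x * |Real.log (jointProb p0 p pol γ x * lastReward r x / qb x)| else 0) ∧
        L = (∑' x, if 0 < qb x then
              qb x * (Real.log (jointProb p0 p pol γ x) + Real.log (lastReward r x)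
                - Real.log (qb x)) else 0) - Real.log (1 - γ)}
      = Real.log (∑' t : ℕ, γ ^ t *
          ∑ τ : Fin (t + 1) → S × A,
            trajProb p0 p pol t τ * r (τ (Fin.last t)).1 (τ (Fin.last t)).2) := by
  have htr := trajProb_nonneg_aux p0 hp00 p hp0 pol hpol0
  have hg1 : 0 < 1 - γ := by linarith
  have hjn : ∀ x, 0 ≤ jointProb p0 p pol γ x := fun x =>
    mul_nonneg (mul_nonneg hg1.le (pow_nonneg hγ0.le _)) (htr _ _)
  have hrp : ∀ x : Σ H : ℕ, Fin (H + 1) → S × A, 0 < lastReward r x := fun x => hr _ _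
  have hfn : ∀ x, 0 ≤ jointProb p0 p pol γ x * lastReward r x := fun x =>
    mul_nonneg (hjn x) (hrp x).le
  -- bounds for the reward
  obtain ⟨M, hM⟩ : ∃ M, ∀ z : S × A, r z.1 z.2 ≤ M := by
    obtain ⟨z, hz⟩ := Finite.exists_max (fun z : S × A => r z.1 z.2)
    exact ⟨_, hz⟩
  obtain ⟨m, hm0, hm⟩ : ∃ m, 0 < m ∧ ∀ z : S × A, m ≤ r z.1 z.2 := by
    obtain ⟨z, hz⟩ := Finite.exists_min (fun z : S × A => r z.1 z.2)
    exact ⟨_, hr _ _, hz⟩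
  have hsum1 := fun t => trajProb_sum_aux p hp1 pol hpol1 t p0 hp01
  set c : ℕ → ℝ := fun t => γ ^ t * ∑ τ : Fin (t + 1) → S × A,
    trajProb p0 p pol t τ * r (τ (Fin.last t)).1 (τ (Fin.last t)).2 with hc
  have hcM : ∀ t, c t ≤ γ ^ t * M := by
    intro t
    refine mul_le_mul_of_nonneg_left ?_ (pow_nonneg hγ0.le _)
    calc _ ≤ ∑ τ : Fin (t + 1) → S × A, trajProb p0 p pol t τ * M :=
          Finset.sum_le_sum fun τ _ => mul_le_mul_of_nonneg_left (hM _) (htr _ _)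
      _ = M := by rw [← Finset.sum_mul, hsum1, one_mul]
  have hcm : ∀ t, γ ^ t * m ≤ c t := by
    intro t
    refine mul_le_mul_of_nonneg_left ?_ (pow_nonneg hγ0.le _)
    calc m = ∑ τ : Fin (t + 1) → S × A, trajProb p0 p pol t τ * m := by
          rw [← Finset.sum_mul, hsum1, one_mul]
      _ ≤ _ := Finset.sum_le_sum fun τ _ => mul_le_mul_of_nonneg_left (hm _) (htr _ _)
  have hcpos : ∀ t, 0 < c t := fun t => lt_of_lt_of_le (by positivity) (hcm t)
  have hcs : Summable c := Summable.of_nonneg_of_le (fun t => (hcpos t).le) hcM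
    ((summable_geometric_of_lt_one hγ0.le hγ1).mul_right M)
  have hJ : 0 < ∑' t, c t := hcs.tsum_pos (fun t => (hcpos t).le) 0 (hcpos 0)
  have hinner : ∀ t : ℕ, ∑ τ : Fin (t + 1) → S × A,
      jointProb p0 p pol γ ⟨t, τ⟩ * lastReward r ⟨t, τ⟩ = (1 - γ) * c t := by
    intro t
    simp only [hc, jointProb, lastReward, Finset.mul_sum]
    refine Finset.sum_congr rfl fun τ _ => ?_
    ring
  have hfs : Summable fun x => jointProb p0 p pol γ x * lastReward r x := by
    rw [summable_sigma_of_nonneg hfn]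
    refine ⟨fun t => Summable.of_finite, ?_⟩
    simp only [tsum_fintype, hinner]
    exact hcs.mul_left _
  have hi : (∑' x, jointProb p0 p pol γ x * lastReward r x) = (1 - γ) * ∑' t, c t := by
    rw [hfs.tsum_sigma]
    simp only [tsum_fintype, hinner]
    exact tsum_mul_left
  have hf : HasSum (fun x => jointProb p0 p pol γ x * lastReward r x)
      ((1 - γ) * ∑' t, c t) := hi ▸ hfs.hasSum
  generalize (∑' t, c t) = J at *
  have hZ : 0 < (1 - γ) * J := mul_pos hg1 hJ
  have hii : ∀ qb : (Σ H : ℕ, Fin (H + 1) → S × A) → ℝ,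
      (∀ x, 0 ≤ qb x) → (∑' x, qb x) = 1 →
      (∀ x, 0 < qb x → 0 < jointProb p0 p pol γ x) →
      (Summable fun x =>
        if 0 < qb x then
          qb x * |Real.log (jointProb p0 p pol γ x * lastReward r x / qb x)| else 0) →
      ((∑' x, if 0 < qb x then
            qb x * (Real.log (jointProb p0 p pol γ x) + Real.log (lastReward r x)
              - Real.log (qb x)) else 0) - Real.log (1 - γ) ≤ Real.log J ∧
        ((∑' x, if 0 < qb x then
              qb x * (Real.log (jointProb p0 p pol γ x) + Real.log (lastReward r x)
                - Real.log (qb x)) else 0) - Real.log (1 - γ) = Real.log J ↔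
          ∀ x, qb x = jointProb p0 p pol γ x * lastReward r x / ((1 - γ) * J))) := by
    intro qb h0 h1 hsupp hs
    have hqs : HasSum qb 1 := by
      have : Summable qb := by
        by_contra hn
        rw [tsum_eq_zero_of_not_summable hn] at h1
        exact zero_ne_one h1
      exact h1 ▸ this.hasSum
    have e : (fun x => if 0 < qb x then
        qb x * (Real.log (jointProb p0 p pol γ x) + Real.log (lastReward r x)
          - Real.log (qb x)) else 0) = fun x => if 0 < qb x then
        qb x * Real.log (jointProb p0 p pol γ x * lastReward r x / qb x) else 0 := by
      funext x
      split_ifs with h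
      · rw [Real.log_div (mul_pos (hsupp x h) (hrp x)).ne' h.ne',
          Real.log_mul (hsupp x h).ne' (hrp x).ne']
      · rfl
    have key := gibbs_aux _ qb _ hfn hZ hf h0 hqs
      (fun x h => mul_pos (hsupp x h) (hrp x)) hs
    rw [e, ← key.2]
    rw [Real.log_mul hg1.ne' hJ.ne'] at key ⊢
    refine ⟨by linarith [key.1], ?_, ?_⟩ <;> intro h <;> linarith
  refine ⟨hi, hii, ?_⟩
  refine IsGreatest.csSup_eq ⟨?_, ?_⟩
  · have a0 : ∀ x, 0 ≤ jointProb p0 p pol γ x * lastReward r x / ((1 - γ) * J) :=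
      fun x => div_nonneg (hfn x) hZ.le
    have a1' := hf.div_const ((1 - γ) * J)
    rw [div_self hZ.ne'] at a1'
    have a2 : ∀ x, 0 < jointProb p0 p pol γ x * lastReward r x / ((1 - γ) * J) →
        0 < jointProb p0 p pol γ x := by
      intro x h
      refine lt_of_le_of_ne (hjn x) fun h' => ?_
      rw [← h'] at h
      simp at h
    have a3 : Summable fun x =>
        if 0 < jointProb p0 p pol γ x * lastReward r x / ((1 - γ) * J) then
          jointProb p0 p pol γ x * lastReward r x / ((1 - γ) * J) *
            |Real.log (jointProb p0 p pol γ x * lastReward r x /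
              (jointProb p0 p pol γ x * lastReward r x / ((1 - γ) * J)))| else 0 := by
      refine (a1'.summable.mul_right |Real.log ((1 - γ) * J)|).congr fun x => ?_
      split_ifs with h
      · have hx : jointProb p0 p pol γ x * lastReward r x ≠ 0 :=
          (mul_pos (a2 x h) (hrp x)).ne'
        rw [div_div_cancel₀ hx]
      · rw [le_antisymm (not_lt.1 h) (a0 x), zero_mul]
    exact ⟨_, a0, a1'.tsum_eq, a2, a3,
      ((hii _ a0 a1'.tsum_eq a2 a3).2.2 fun x => rfl).symm⟩
  · rintro L ⟨qb, h0, h1, h2, h3, rfl⟩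
    exact (hii qb h0 h1 h2 h3).1
end
end

section
/- Let X be a countable type and let p, q : X → ℝ be two probability mass functions on X. Adopt the convention 0·log 0 = 0. For any function C : X → ℝ with 0 < C(x) < 1 for all x, define the discrimination objective D(C) = ∑_{x∈X} (p(x)·log C(x) + q(x)·log(1−C(x))), a sum of nonpositive terms with value in [−∞, 0). Then D(C) ≤ ∑_{x : p(x)+q(x)>0} (p(x)·log(p(x)/(p(x)+q(x))) + q(x)·log(q(x)/(p(x)+q(x)))), i.e., the objective is maximized by the Bayes-optimal classifier C*(x) = p(x)/(p(x)+q(x)). Moreover, for every x with p(x) > 0 and q(x) > 0, the optimal classifier's log-odds recover the log density ratio: log(C*(x)/(1−C*(x))) = log(p(x)/q(x)). -/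
open scoped BigOperators Classical

theorem bayes_aux (p s c : ℝ) (hp : 0 ≤ p) (hs : 0 < s) (hc : 0 < c) :
    p * Real.log c ≤ p * Real.log (p / s) + c * s - p := by
  rcases hp.eq_or_lt with h | h
  · subst h
    have := mul_pos hc hs
    simp only [zero_mul]
    linarith
  · have h1 : Real.log (c * s / p) ≤ c * s / p - 1 :=
      Real.log_le_sub_one_of_pos (by positivity)
    have h2 : Real.log (c * s / p) = Real.log c - Real.log (p / s) := by
      rw [← Real.log_div hc.ne' (by positivity)]
      congr 1
      field_simp
    have h3 := mul_le_mul_of_nonneg_left h1 hp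
    have h4 : p * (c * s / p - 1) = c * s - p := by field_simp
    rw [h2, h4] at h3
    linarith

theorem ereal_summable_of_nonpos {X : Type*} (f : X → EReal) (hf : ∀ x, f x ≤ 0) :
    Summable f := by
  refine ⟨⨅ s : Finset X, ∑ x ∈ s, f x, ?_⟩
  refine tendsto_atTop_iInf ?_
  intro s t hst
  exact Finset.sum_le_sum_of_subset_of_nonpos' hst (fun x _ _ => hf x)

/-- **Bayes-optimal discriminator (Section 4.1).** For pmfs `p, q` on a countable type and
any classifier `C` with values in `(0,1)`, the cross-entropy objective
`D(C) = ∑_x (p(x) log C(x) + q(x) log(1−C(x)))` (a sum of nonpositive terms, taking values in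
`[−∞, 0)`, hence computed in `EReal`) is at most its value at the Bayes-optimal classifier
`C*(x) = p(x)/(p(x)+q(x))`; moreover, wherever `p(x) > 0` and `q(x) > 0`, the log-odds of
`C*` recover the log density ratio `log(p(x)/q(x))`. -/
theorem bayes_optimal_classifier {X : Type*} [Countable X]
    (p q : X → ℝ) (hp0 : ∀ x, 0 ≤ p x) (hp1 : ∑' x, p x = 1)
    (hq0 : ∀ x, 0 ≤ q x) (hq1 : ∑' x, q x = 1)
    (C : X → ℝ) (hC0 : ∀ x, 0 < C x) (hC1 : ∀ x, C x < 1) :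
    (∑' x, ((p x * Real.log (C x) + q x * Real.log (1 - C x) : ℝ) : EReal))
      ≤ ((∑' x, if 0 < p x + q x then
            p x * Real.log (p x / (p x + q x)) + q x * Real.log (q x / (p x + q x))
          else 0 : ℝ) : EReal) ∧
    ∀ x, 0 < p x → 0 < q x →
      Real.log ((p x / (p x + q x)) / (1 - p x / (p x + q x)))
        = Real.log (p x / q x) := by
  have hp : Summable p := by
    by_contra h
    rw [tsum_eq_zero_of_not_summable h] at hp1
    exact zero_ne_one hp1
  have hq : Summable q := by
    by_contra h
    rw [tsum_eq_zero_of_not_summable h] at hq1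
    exact zero_ne_one hq1
  constructor
  · set g : X → ℝ := fun x => if 0 < p x + q x then
            p x * Real.log (p x / (p x + q x)) + q x * Real.log (q x / (p x + q x))
          else 0 with hg
    have hgs : Summable g := by
      refine Summable.of_norm_bounded (hp.add hq) ?_
      intro x
      have h1 := hp0 x
      have h2 := hq0 x
      simp only [hg]
      split_ifs with h
      · have a1 := bayes_aux (p x) (p x + q x) 1 h1 h one_pos
        have a2 := bayes_aux (q x) (p x + q x) 1 h2 h one_pos
        rw [Real.log_one] at a1 a2
        have b1 : Real.log (p x / (p x + q x)) ≤ 0 :=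
          Real.log_nonpos (by positivity) ((div_le_one h).2 (by linarith))
        have b2 : Real.log (q x / (p x + q x)) ≤ 0 :=
          Real.log_nonpos (by positivity) ((div_le_one h).2 (by linarith))
        have c1 := mul_nonpos_of_nonneg_of_nonpos h1 b1
        have c2 := mul_nonpos_of_nonneg_of_nonpos h2 b2
        rw [Real.norm_eq_abs, abs_le]
        constructor <;> linarith
      · simp only [norm_zero]
        linarith
    have hG : HasSum (fun x => ((g x : ℝ) : EReal)) ((∑' x, g x : ℝ) : EReal) := by
      have := (continuous_coe_real_ereal.tendsto (∑' x, g x)).comp hgs.hasSum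
      refine this.congr ?_
      intro s
      simp only [Function.comp]
      induction s using Finset.induction_on with
      | empty => simp
      | insert a s ha ih => rw [Finset.sum_insert ha, Finset.sum_insert ha, EReal.coe_add, ih]
    refine hasSum_le ?_ (ereal_summable_of_nonpos _ ?_).hasSum hG
    · intro x
      rw [EReal.coe_le_coe_iff]
      have h1 := hp0 x
      have h2 := hq0 x
      simp only [hg]
      split_ifs with h
      · have a1 := bayes_aux (p x) (p x + q x) (C x) h1 h (hC0 x)
        have a2 := bayes_aux (q x) (p x + q x) (1 - C x) h2 h (by linarith [hC1 x])
        linarith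
      · have e1 : p x = 0 := by linarith
        have e2 : q x = 0 := by linarith
        simp [e1, e2]
    · intro x
      rw [← EReal.coe_zero, EReal.coe_le_coe_iff]
      have b1 := Real.log_nonpos (hC0 x).le (hC1 x).le
      have b2 : Real.log (1 - C x) ≤ 0 :=
        Real.log_nonpos (by linarith [hC1 x]) (by linarith [hC0 x])
      have c1 := mul_nonpos_of_nonneg_of_nonpos (hp0 x) b1
      have c2 := mul_nonpos_of_nonneg_of_nonpos (hq0 x) b2
      linarith
  · intro x h1 h2
    congr 1
    have h3 : 1 - p x / (p x + q x) = q x / (p x + q x) := by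
      field_simp
      ring
    rw [h3]
    field_simp
end
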